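/- arXiv:1807.08091 — 2 statements merged into one kernel-verified Lean document; each statement's English description precedes it below -/
import Mathlib

section
/- Let l : ℝⁿ → ℝ be differentiable with l(0) = 0, c_m-restricted strongly concave and C̃_m-restricted smooth on the nonnegative orthant. Let S ⊆ {1,…,n} with |S| = m be such that ∇_j l(0) ≥ ∇_p l(0) for every j ∈ S and every p ∉ S, and assume an L-maximizer ζ^(L) of l exists for every finite L (write f(L) = l(ζ^(L))). Then for every set T ⊆ {1,…,n} with |T| ≤ m, f(S) ≥ (c_m / C̃_m) · f(T). -/
open Finset

/-- componentwise nonnegativity -/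
def Nonneg {n : ℕ} (x : Fin n → ℝ) : Prop := ∀ i, 0 ≤ x i

/-- the j-th partial derivative of l at x -/
noncomputable def pgrad {n : ℕ} (l : (Fin n → ℝ) → ℝ) (x : Fin n → ℝ) (j : Fin n) : ℝ :=
  fderiv ℝ l x (Pi.single j 1)

/-- `l` is `C`-restricted smooth (RSM) at sparsity level `k` on the nonnegative orthant -/
def RSM {n : ℕ} (l : (Fin n → ℝ) → ℝ) (k : ℕ) (C : ℝ) : Prop :=
  ∀ x y : Fin n → ℝ, Nonneg x → Nonneg y → {i | y i - x i ≠ 0}.ncard ≤ k →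
    l y - l x - fderiv ℝ l x (y - x) ≥ -(C / 2) * ∑ i, (y i - x i) ^ 2

/-- `l` is `c`-restricted strongly concave (RSC) at sparsity level `k`
on the nonnegative orthant -/
def RSC {n : ℕ} (l : (Fin n → ℝ) → ℝ) (k : ℕ) (c : ℝ) : Prop :=
  ∀ x y : Fin n → ℝ, Nonneg x → Nonneg y →
    {i | x i ≠ 0}.ncard ≤ k → {i | y i ≠ 0}.ncard ≤ k →
    l y - l x - fderiv ℝ l x (y - x) ≤ -(c / 2) * ∑ i, (y i - x i) ^ 2

/-- `ζ` is an `L`-maximizer of `l`: nonnegative, supported in `L`, and maximal among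
such points -/
def IsMaximizerOn {n : ℕ} (l : (Fin n → ℝ) → ℝ) (L : Finset (Fin n)) (ζ : Fin n → ℝ) : Prop :=
  Nonneg ζ ∧ (∀ i, ζ i ≠ 0 → i ∈ L) ∧
    ∀ w : Fin n → ℝ, Nonneg w → (∀ i, w i ≠ 0 → i ∈ L) → l w ≤ l ζ

/-- A set `S` carrying the largest values of a nonnegative function `h` has the largest `h`-sum
among sets of at most its cardinality. -/
theorem sum_le_sum_of_card_le_of_forall_le {ι : Type*} [DecidableEq ι] {h : ι → ℝ}
    (h0 : ∀ i, 0 ≤ h i) {S T : Finset ι} (hcard : T.card ≤ S.card)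
    (htop : ∀ j ∈ S, ∀ p ∉ S, h p ≤ h j) : ∑ i ∈ T, h i ≤ ∑ i ∈ S, h i := by
  have hdiff : ∑ i ∈ T \ S, h i ≤ ∑ i ∈ S \ T, h i := by
    rcases (T \ S).eq_empty_or_nonempty with hE | hE
    · rw [hE, sum_empty]
      exact sum_nonneg fun i _ => h0 i
    · obtain ⟨p, hp, hmax⟩ := exists_max_image (T \ S) h hE
      have hle : (T \ S).card ≤ (S \ T).card := by
        have h1 := card_sdiff_add_card_inter T S
        have h2 := card_sdiff_add_card_inter S T
        rw [inter_comm] at h2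
        omega
      calc ∑ i ∈ T \ S, h i ≤ (T \ S).card • h p := sum_le_card_nsmul _ _ _ hmax
        _ ≤ (S \ T).card • h p := nsmul_le_nsmul_left (h0 p) hle
        _ ≤ ∑ i ∈ S \ T, h i := card_nsmul_le_sum _ _ _ fun j hj =>
            htop j (mem_sdiff.1 hj).1 p (mem_sdiff.1 hp).2
  have h1 := sum_inter_add_sum_sdiff T S h
  have h2 := sum_inter_add_sum_sdiff S T h
  rw [inter_comm] at h2
  linarith

theorem fderiv_eq_sum_pgrad {n : ℕ} (l : (Fin n → ℝ) → ℝ) (x v : Fin n → ℝ) :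
    fderiv ℝ l x v = ∑ i, v i * pgrad l x i := by
  refine (LinearMap.pi_apply_eq_sum_univ (fderiv ℝ l x).toLinearMap v).trans
    (sum_congr rfl fun i _ => ?_)
  have hsingle : (fun j => if i = j then (1 : ℝ) else 0) = Pi.single i 1 := by
    ext j
    simp [Pi.single_apply, eq_comm]
  rw [hsingle]
  rfl

theorem ncard_support_le {n : ℕ} {z : Fin n → ℝ} {L : Finset (Fin n)}
    (hz : ∀ i, z i ≠ 0 → i ∈ L) : {i | z i ≠ 0}.ncard ≤ L.card := by
  rw [← Set.ncard_coe_finset L]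
  exact Set.ncard_le_ncard hz L.finite_toSet

/-- Restricted strong concavity bounds `l` on vectors supported in `T` by the positive parts of
the partial derivatives at `0`. -/
theorem RSC.le_sum_sq_posPart {n k : ℕ} {l : (Fin n → ℝ) → ℝ} {c : ℝ} (hl0 : l 0 = 0)
    (hc : 0 < c) (h : RSC l k c) {T : Finset (Fin n)} (hT : T.card ≤ k) {z : Fin n → ℝ}
    (hz0 : Nonneg z) (hzT : ∀ i, z i ≠ 0 → i ∈ T) :
    c * l z ≤ (∑ i ∈ T, max (pgrad l 0 i) 0 ^ 2) / 2 := by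
  have key := h 0 z (fun _ => le_rfl) hz0 (by simp) ((ncard_support_le hzT).trans hT)
  simp only [hl0, sub_zero, fderiv_eq_sum_pgrad, Pi.zero_apply] at key
  have hz : ∀ i ∉ T, z i = 0 := fun i hi => by_contra fun hne => hi (hzT i hne)
  rw [← sum_subset (subset_univ T) fun i _ hi => by rw [hz i hi, zero_mul],
    ← sum_subset (subset_univ T) fun i _ hi => by rw [hz i hi]; ring] at key
  have hterm : ∑ i ∈ T, (2 * c * (z i * pgrad l 0 i) - c ^ 2 * z i ^ 2) ≤
      ∑ i ∈ T, max (pgrad l 0 i) 0 ^ 2 := by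
    refine sum_le_sum fun i _ => ?_
    have hmul := mul_le_mul_of_nonneg_left (le_max_left (pgrad l 0 i) 0)
      (mul_nonneg hc.le (hz0 i))
    nlinarith [sq_nonneg (c * z i - max (pgrad l 0 i) 0)]
  rw [sum_sub_distrib, ← mul_sum, ← mul_sum] at hterm
  nlinarith [mul_le_mul_of_nonneg_left key hc.le]

/-- Restricted smoothness bounds the maximum of `l` over vectors supported in `S` from below by
the positive parts of the partial derivatives at `0`. -/
theorem RSM.sum_sq_posPart_le {n k : ℕ} {l : (Fin n → ℝ) → ℝ} {C : ℝ} (hl0 : l 0 = 0)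
    (hC : 0 < C) (h : RSM l k C) {S : Finset (Fin n)} (hS : S.card ≤ k) {z : Fin n → ℝ}
    (hz : IsMaximizerOn l S z) :
    (∑ i ∈ S, max (pgrad l 0 i) 0 ^ 2) / 2 ≤ C * l z := by
  set w : Fin n → ℝ := fun i => if i ∈ S then max (pgrad l 0 i) 0 / C else 0 with hw
  have hw0 : Nonneg w := fun i => by
    simp only [hw]
    split_ifs <;> positivity
  have hwS : ∀ i, w i ≠ 0 → i ∈ S := fun i hi => by
    by_contra hne
    exact hi (if_neg hne)
  have hmax := hz.2.2 w hw0 hwS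
  have key := h 0 w (fun _ => le_rfl) hw0 (by simpa using (ncard_support_le hwS).trans hS)
  simp only [hl0, sub_zero, fderiv_eq_sum_pgrad, Pi.zero_apply] at key
  have hwz : ∀ i ∉ S, w i = 0 := fun i hi => if_neg hi
  rw [← sum_subset (subset_univ S) fun i _ hi => by rw [hwz i hi, zero_mul],
    ← sum_subset (subset_univ S) fun i _ hi => by rw [hwz i hi]; ring] at key
  have hterm : ∑ i ∈ S, (2 * C * (w i * pgrad l 0 i) - C ^ 2 * w i ^ 2) =
      ∑ i ∈ S, max (pgrad l 0 i) 0 ^ 2 := by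
    refine sum_congr rfl fun i hi => ?_
    have hCw : C * w i = max (pgrad l 0 i) 0 := by
      rw [hw]
      simp only [if_pos hi]
      field_simp
    have hsq : max (pgrad l 0 i) 0 * pgrad l 0 i = max (pgrad l 0 i) 0 ^ 2 := by
      rcases max_cases (pgrad l 0 i) 0 with ⟨h1, _⟩ | ⟨h1, _⟩ <;> rw [h1] <;> ring
    linear_combination (2 * pgrad l 0 i - C * w i - max (pgrad l 0 i) 0) * hCw + 2 * hsq
  rw [sum_sub_distrib, ← mul_sum, ← mul_sum] at hterm
  nlinarith [mul_le_mul_of_nonneg_left key hC.le, mul_le_mul_of_nonneg_left hmax hC.le]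

/-- Theorem 5.3: constant factor guarantee for RSC and RSM functions (ProtoBasic). -/
theorem protobasic_constant_factor {n m : ℕ} (l : (Fin n → ℝ) → ℝ)
    (hl : Differentiable ℝ l) (hl0 : l 0 = 0)
    (cm Cm : ℝ) (hcm : 0 < cm) (hCm : 0 < Cm)
    (hRSC : RSC l m cm) (hRSM : RSM l m Cm)
    (S : Finset (Fin n)) (hScard : S.card = m)
    (htop : ∀ j ∈ S, ∀ p ∉ S, pgrad l 0 p ≤ pgrad l 0 j)
    (ζ : Finset (Fin n) → (Fin n → ℝ)) (hζ : ∀ L, IsMaximizerOn l L (ζ L)) :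
    ∀ T : Finset (Fin n), T.card ≤ m → l (ζ S) ≥ (cm / Cm) * l (ζ T) := by
  intro T hT
  have hlower := hRSM.sum_sq_posPart_le hl0 hCm hScard.le (hζ S)
  have hupper := hRSC.le_sum_sq_posPart hl0 hcm hT (hζ T).1 (hζ T).2.1
  have hsum := sum_le_sum_of_card_le_of_forall_le
    (h := fun i => max (pgrad l 0 i) 0 ^ 2) (fun i => sq_nonneg _) (hT.trans hScard.ge)
    fun j hj p hp => pow_le_pow_left₀ (le_max_right _ _) (max_le_max_right 0 (htop j hj p hp)) 2
  rw [ge_iff_le, div_mul_eq_mul_div, div_le_iff₀ hCm]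
  linarith
end

section
/- Let l : ℝⁿ → ℝ be differentiable, c_{|L|+|S|}-RSC, c_{|L|+1}-RSC, C̃_1-RSM and C̃_{|S|}-RSM on the nonnegative orthant, where L, S ⊆ {1,…,n} are disjoint finite sets, and assume an L'-maximizer ζ^(L') of l exists for every finite L' (write f(L') = l(ζ^(L'))). Then (c_{|L|+|S|} / C̃_1) · (f(L∪S) − f(L)) ≤ Σ_{j∈S} (f(L∪{j}) − f(L)) ≤ (C̃_{|S|} / c_{|L|+1}) · (f(L∪S) − f(L)); in particular, whenever f(L∪S) > f(L), the submodularity ratio γ_{L,S} = Σ_{j∈S}(f(L∪{j}) − f(L)) / (f(L∪S) − f(L)) satisfies c_{|L|+|S|}/C̃_1 ≤ γ_{L,S} ≤ C̃_{|S|}/c_{|L|+1}. -/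
open Finset

/-- The derivative of `l` at an `L`-maximizer is nonpositive along every feasible direction. -/
theorem IsMaximizerOn.fderiv_sub_nonpos {n : ℕ} {l : (Fin n → ℝ) → ℝ}
    (hl : Differentiable ℝ l) {L : Finset (Fin n)} {z w : Fin n → ℝ}
    (hz : IsMaximizerOn l L z) (hw : Nonneg w) (hwL : ∀ i, w i ≠ 0 → i ∈ L) :
    fderiv ℝ l z (w - z) ≤ 0 := by
  obtain ⟨hz0, hzL, hzmax⟩ := hz
  let s : Set (Fin n → ℝ) := {v | Nonneg v ∧ ∀ i, v i ≠ 0 → i ∈ L}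
  have hmax : IsLocalMaxOn l s z :=
    IsMaxOn.localize fun v hv => hzmax v hv.1 hv.2
  have hconv : Convex ℝ s := by
    intro u hu v hv a b ha hb _
    refine ⟨fun i => ?_, fun i hi => ?_⟩
    · have h1 := mul_nonneg ha (hu.1 i)
      have h2 := mul_nonneg hb (hv.1 i)
      simpa using add_nonneg h1 h2
    · by_contra hiL
      have h1 : u i = 0 := by_contra fun h => hiL (hu.2 i h)
      have h2 : v i = 0 := by_contra fun h => hiL (hv.2 i h)
      exact hi (by simp [h1, h2])
  exact hmax.hasFDerivWithinAt_nonpos (hl z).hasFDerivAt.hasFDerivWithinAt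
    (sub_mem_posTangentConeAt_of_segment_subset
      (hconv.segment_subset ⟨hz0, hzL⟩ ⟨hw, hwL⟩))

/-- A directional derivative of `l` is the sum of partial derivatives weighted by the direction,
taken over any finite set containing the support of the direction. -/
theorem fderiv_apply_eq_sum_pgrad {n : ℕ} (l : (Fin n → ℝ) → ℝ) (z v : Fin n → ℝ)
    {S : Finset (Fin n)} (hv : ∀ i, v i ≠ 0 → i ∈ S) :
    fderiv ℝ l z v = ∑ j ∈ S, v j * pgrad l z j := by
  have h : v = ∑ j ∈ S, v j • (Pi.single j 1 : Fin n → ℝ) := by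
    ext i
    rw [Finset.sum_apply]
    by_cases hi : i ∈ S
    · simp [Pi.single_apply, hi]
    · have : v i = 0 := by_contra fun h => hi (hv i h)
      simp [Pi.single_apply, hi, this]
  conv_lhs => rw [h]
  simp [map_sum, pgrad]

/-- Under restricted strong concavity, the gain from adding `S` to `L` is bounded above by the
positive part of the gradient on `S`. -/
theorem RSC.gain_le {n : ℕ} {l : (Fin n → ℝ) → ℝ} (hl : Differentiable ℝ l)
    {L S : Finset (Fin n)} (hdisj : Disjoint L S) {c : ℝ} (hc : 0 < c)
    (hRSC : RSC l (L.card + S.card) c) {z y : Fin n → ℝ}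
    (hz : IsMaximizerOn l L z) (hy : IsMaximizerOn l (L ∪ S) y) :
    l y - l z ≤ (∑ j ∈ S, (max (pgrad l z j) 0) ^ 2) / (2 * c) := by
  have hcard : ∀ v : Fin n → ℝ, (∀ i, v i ≠ 0 → i ∈ L ∪ S) →
      {i | v i ≠ 0}.ncard ≤ L.card + S.card := fun v hv => by
    rw [← Finset.card_union_of_disjoint hdisj, ← Set.ncard_coe_finset]
    exact Set.ncard_le_ncard hv (Finset.finite_toSet _)
  have hconc := hRSC z y hz.1 hy.1
    (hcard z fun i hi => Finset.mem_union_left S (hz.2.1 i hi)) (hcard y hy.2.1)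
  let w : Fin n → ℝ := fun i => if i ∈ L then y i else 0
  let v : Fin n → ℝ := fun i => if i ∈ S then y i else 0
  have hzS : ∀ j ∈ S, z j = 0 := fun j hj =>
    by_contra fun h => Finset.disjoint_left.mp hdisj (hz.2.1 j h) hj
  have hfirst : fderiv ℝ l z (w - z) ≤ 0 := by
    refine hz.fderiv_sub_nonpos hl (fun i => ?_) (fun i hi => ?_)
    · by_cases h : i ∈ L <;> simp [w, h, hy.1 i]
    · by_contra h
      simp [w, h] at hi
  have hsplit : y - z = (w - z) + v := by
    ext i
    by_cases hiL : i ∈ L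
    · simp [w, v, hiL, Finset.disjoint_left.mp hdisj hiL]
    · by_cases hiS : i ∈ S
      · simp [w, v, hiL, hiS]; ring
      · have : y i = 0 := by_contra fun h => by
          simpa [hiL, hiS] using hy.2.1 i h
        simp [w, v, hiL, hiS, this]
  have hv : fderiv ℝ l z v = ∑ j ∈ S, y j * pgrad l z j := by
    rw [fderiv_apply_eq_sum_pgrad l z v (S := S) fun i hi => by
      by_contra h
      simp [v, h] at hi]
    exact Finset.sum_congr rfl fun j hj => by simp [v, hj]
  have hnorm : ∑ j ∈ S, y j ^ 2 ≤ ∑ i, (y i - z i) ^ 2 := by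
    calc ∑ j ∈ S, y j ^ 2 = ∑ j ∈ S, (y j - z j) ^ 2 :=
          Finset.sum_congr rfl fun j hj => by simp [hzS j hj]
      _ ≤ ∑ i, (y i - z i) ^ 2 :=
          Finset.sum_le_univ_sum_of_nonneg fun i => sq_nonneg _
  have hquad : ∑ j ∈ S, y j * pgrad l z j - c / 2 * ∑ j ∈ S, y j ^ 2 ≤
      (∑ j ∈ S, (max (pgrad l z j) 0) ^ 2) / (2 * c) := by
    rw [Finset.mul_sum, ← Finset.sum_sub_distrib, Finset.sum_div]
    refine Finset.sum_le_sum fun j _ => ?_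
    rw [le_div_iff₀ (by positivity)]
    have h1 := mul_le_mul_of_nonneg_left (le_max_left (pgrad l z j) 0)
      (mul_nonneg hc.le (hy.1 j))
    nlinarith [sq_nonneg (max (pgrad l z j) 0 - c * y j)]
  rw [hsplit, map_add, hv] at hconc
  have := mul_le_mul_of_nonneg_left hnorm (half_pos hc).le
  linarith

/-- Under restricted smoothness, the gain from adding `S` to `L` is bounded below by the
positive part of the gradient on `S`. -/
theorem RSM.le_gain {n : ℕ} {l : (Fin n → ℝ) → ℝ} {L S : Finset (Fin n)} {C : ℝ} (hC : 0 < C)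
    (hRSM : RSM l S.card C) {z y : Fin n → ℝ}
    (hz : IsMaximizerOn l L z) (hy : IsMaximizerOn l (L ∪ S) y) :
    (∑ j ∈ S, (max (pgrad l z j) 0) ^ 2) / (2 * C) ≤ l y - l z := by
  let t : Fin n → ℝ := fun i => if i ∈ S then max (pgrad l z i) 0 / C else 0
  have htS : ∀ i, t i ≠ 0 → i ∈ S := fun i hi => by
    by_contra h
    simp [t, h] at hi
  have ht0 : Nonneg t := fun i => by
    by_cases h : i ∈ S
    · simp only [t, h, if_true]
      positivity
    · simp [t, h]
  have hzt : Nonneg (z + t) := fun i => add_nonneg (hz.1 i) (ht0 i)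
  have hmax : l (z + t) ≤ l y := by
    refine hy.2.2 _ hzt fun i hi => ?_
    by_cases h : z i = 0
    · exact Finset.mem_union_right L (htS i (by simpa [h] using hi))
    · exact Finset.mem_union_left S (hz.2.1 i h)
  have hsmooth := hRSM z (z + t) hz.1 hzt (by
    rw [← Set.ncard_coe_finset]
    exact Set.ncard_le_ncard (fun i hi => htS i (by simpa using hi)) (Finset.finite_toSet _))
  have hsq : ∑ i, ((z + t) i - z i) ^ 2 = ∑ j ∈ S, t j ^ 2 := by
    refine (Finset.sum_subset (Finset.subset_univ S) fun i _ hi => ?_).symm.trans ?_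
    · simp [t, hi]
    · simp
  rw [add_sub_cancel_left, fderiv_apply_eq_sum_pgrad l z t htS, hsq] at hsmooth
  have hquad : ∑ j ∈ S, t j * pgrad l z j - C / 2 * ∑ j ∈ S, t j ^ 2 =
      (∑ j ∈ S, (max (pgrad l z j) 0) ^ 2) / (2 * C) := by
    rw [Finset.mul_sum, ← Finset.sum_sub_distrib, Finset.sum_div]
    refine Finset.sum_congr rfl fun j hj => ?_
    have hpos : max (pgrad l z j) 0 * pgrad l z j = max (pgrad l z j) 0 ^ 2 := by
      rcases le_total (pgrad l z j) 0 with h | h <;> simp [h, sq]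
    simp only [t, hj, if_true]
    rw [div_mul_eq_mul_div, hpos]
    field_simp
    ring
  linarith

/-- Lemma 5.4: bounds on the submodularity ratio for RSC and RSM functions. -/
theorem submodularity_ratio_bounds {n : ℕ} (l : (Fin n → ℝ) → ℝ)
    (hl : Differentiable ℝ l)
    (L S : Finset (Fin n)) (hdisj : Disjoint L S)
    (cLS cL1 C1 CS : ℝ) (hcLS : 0 < cLS) (hcL1 : 0 < cL1) (hC1 : 0 < C1) (hCS : 0 < CS)
    (hRSC_LS : RSC l (L.card + S.card) cLS) (hRSC_L1 : RSC l (L.card + 1) cL1)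
    (hRSM_1 : RSM l 1 C1) (hRSM_S : RSM l S.card CS)
    (ζ : Finset (Fin n) → (Fin n → ℝ)) (hζ : ∀ L', IsMaximizerOn l L' (ζ L')) :
    (cLS / C1) * (l (ζ (L ∪ S)) - l (ζ L)) ≤
        ∑ j ∈ S, (l (ζ (L ∪ {j})) - l (ζ L)) ∧
    ∑ j ∈ S, (l (ζ (L ∪ {j})) - l (ζ L)) ≤
        (CS / cL1) * (l (ζ (L ∪ S)) - l (ζ L)) ∧
    (l (ζ L) < l (ζ (L ∪ S)) →
      cLS / C1 ≤
          (∑ j ∈ S, (l (ζ (L ∪ {j})) - l (ζ L))) / (l (ζ (L ∪ S)) - l (ζ L)) ∧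
      (∑ j ∈ S, (l (ζ (L ∪ {j})) - l (ζ L))) / (l (ζ (L ∪ S)) - l (ζ L)) ≤
          CS / cL1) := by
  have hsingle : ∀ j ∈ S, Disjoint L {j} := fun j hj =>
    Finset.disjoint_singleton_right.mpr fun h => Finset.disjoint_left.mp hdisj h hj
  have hgain_le := hRSC_LS.gain_le hl hdisj hcLS (hζ L) (hζ (L ∪ S))
  have hle_gain := hRSM_S.le_gain hCS (hζ L) (hζ (L ∪ S))
  have hsum_le : ∑ j ∈ S, (l (ζ (L ∪ {j})) - l (ζ L)) ≤
      (∑ j ∈ S, (max (pgrad l (ζ L) j) 0) ^ 2) / (2 * cL1) := by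
    rw [Finset.sum_div]
    refine Finset.sum_le_sum fun j hj => ?_
    simpa using RSC.gain_le hl (hsingle j hj) hcL1 (by simpa using hRSC_L1)
      (hζ L) (hζ (L ∪ {j}))
  have hle_sum : (∑ j ∈ S, (max (pgrad l (ζ L) j) 0) ^ 2) / (2 * C1) ≤
      ∑ j ∈ S, (l (ζ (L ∪ {j})) - l (ζ L)) := by
    rw [Finset.sum_div]
    refine Finset.sum_le_sum fun j _ => ?_
    simpa using RSM.le_gain (S := {j}) hC1 (by simpa using hRSM_1) (hζ L) (hζ (L ∪ {j}))
  have hlower : (cLS / C1) * (l (ζ (L ∪ S)) - l (ζ L)) ≤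
      ∑ j ∈ S, (l (ζ (L ∪ {j})) - l (ζ L)) := by
    refine (mul_le_mul_of_nonneg_left hgain_le (by positivity)).trans (le_of_eq_of_le ?_ hle_sum)
    field_simp
  have hupper : ∑ j ∈ S, (l (ζ (L ∪ {j})) - l (ζ L)) ≤
      (CS / cL1) * (l (ζ (L ∪ S)) - l (ζ L)) := by
    refine (hsum_le.trans_eq ?_).trans (mul_le_mul_of_nonneg_left hle_gain (by positivity))
    field_simp
  exact ⟨hlower, hupper, fun h =>
    ⟨(le_div_iff₀ (sub_pos.mpr h)).mpr hlower, (div_le_iff₀ (sub_pos.mpr h)).mpr hupper⟩⟩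
end
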